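/- Let z₁ < ⋯ < z_m be real numbers and let Q be meromorphic on the upper half-plane ℍ = {z ∈ ℂ : Im z > 0}. Suppose Q extends continuously to ℝ∖{z₁,…,z_m}, that this boundary extension is nonvanishing there, and that on each of the m+1 connected open intervals of ℝ∖{z₁,…,z_m} there is a constant θ_k ∈ [0,π) with e^{−2iθ_k}·Q(x) ∈ (0,∞) for all x in that interval (i.e., each boundary interval is a θ_k-trajectory arc of Q(z)dz²). Then there exists a function Ψ meromorphic on ℂ∖{z₁,…,z_m} such that Ψ(z) = Q'(z)/Q(z) for every z ∈ ℍ at which Q is holomorphic and nonzero, and Ψ(conj(z)) = conj(Ψ(z)) for all z ∈ ℂ∖(ℝ ∪ {z₁,…,z_m}). (Key reflection step in the proof of Theorem 1.1: the logarithmic derivative Q'/Q of a Kühnau quadratic differential on ℍ extends, by Schwarz reflection across each boundary trajectory arc, to a meromorphic function on the plane minus the corner points.) -/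

import Mathlib

open Complex

/-- The `k`-th connected open interval of `ℝ ∖ {z 0, …, z (m-1)}` for a strictly
increasing tuple `z : Fin m → ℝ`: the set of `x` lying strictly above all `z j` with
`j < k` and strictly below all `z j` with `j ≥ k`.  (For `k = 0` this is `(-∞, z 0)`,
for `0 < k < m` it is `(z (k-1), z k)`, and for `k = m` it is `(z (m-1), ∞)`.) -/
def intervalOf (m : ℕ) (z : Fin m → ℝ) (k : Fin (m + 1)) : Set ℝ :=
  {x | (∀ j : Fin m, (j : ℕ) < (k : ℕ) → z j < x) ∧
       (∀ j : Fin m, (k : ℕ) ≤ (j : ℕ) → x < z j)}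

section KQ

open Set Filter Topology Interval Complex

lemma kq_rect_half (V : Set ℂ) (F : ℂ → ℂ) (hV : IsOpen V) (hF : ContinuousOn F V)
    (hd : DifferentiableOn ℂ F (V ∩ {w : ℂ | w.im ≠ 0})) (a b s t : ℝ)
    (hsub : ([[a, b]] ×ℂ [[s, t]]) ⊆ V)
    (h0 : (0 : ℝ) ∉ Ioo (min s t) (max s t)) :
    (∫ x : ℝ in a..b, F (x + s * I)) - (∫ x : ℝ in a..b, F (x + t * I)) +
      I • (∫ y : ℝ in s..t, F (b + y * I)) -
      I • (∫ y : ℝ in s..t, F (a + y * I)) = 0 := by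
  have := integral_boundary_rect_eq_zero_of_continuousOn_of_differentiableOn F ⟨a, s⟩ ⟨b, t⟩
    (hF.mono hsub) (hd.mono ?_)
  · simpa using this
  · rintro w ⟨h1, h2⟩
    refine ⟨hsub ⟨Ioo_subset_Icc_self h1, Ioo_subset_Icc_self h2⟩, ?_⟩
    intro h
    have h2' : w.im ∈ Ioo (min s t) (max s t) := h2
    rw [h] at h2'
    exact h0 h2'

lemma kq_line_removable (V : Set ℂ) (F : ℂ → ℂ) (hV : IsOpen V) (hF : ContinuousOn F V)
    (hd : DifferentiableOn ℂ F (V ∩ {w : ℂ | w.im ≠ 0})) : DifferentiableOn ℂ F V := by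
  refine (isConservativeOn_and_continuousOn_iff_isDifferentiableOn hV).1 ⟨?_, hF⟩
  intro z w hzw
  rw [← add_eq_zero_iff_eq_neg, wedgeIntegral_add_wedgeIntegral_eq]
  by_cases h0 : (0 : ℝ) ∈ [[z.im, w.im]]
  swap
  · refine kq_rect_half V F hV hF hd _ _ _ _ hzw ?_
    exact fun h => h0 (Ioo_subset_Icc_self h)
  have s1 : [[z.im, 0]] ⊆ [[z.im, w.im]] := uIcc_subset_uIcc left_mem_uIcc h0
  have s2 : [[0, w.im]] ⊆ [[z.im, w.im]] := uIcc_subset_uIcc h0 right_mem_uIcc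
  have e1 := kq_rect_half V F hV hF hd z.re w.re z.im 0
    (fun u hu => hzw ⟨hu.1, s1 hu.2⟩) (by
      rintro ⟨h1, h2⟩
      rcases le_total z.im 0 with h | h <;> simp [h] at h1 h2)
  have e2 := kq_rect_half V F hV hF hd z.re w.re 0 w.im
    (fun u hu => hzw ⟨hu.1, s2 hu.2⟩) (by
      rintro ⟨h1, h2⟩
      rcases le_total w.im 0 with h | h <;> simp [h] at h1 h2)
  have ii : ∀ c ∈ [[z.re, w.re]], ∀ s t : ℝ, [[s, t]] ⊆ [[z.im, w.im]] →
      IntervalIntegrable (fun y : ℝ => F (c + y * I)) MeasureTheory.volume s t := by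
    intro c hc s t hst
    apply ContinuousOn.intervalIntegrable
    apply hF.comp (by fun_prop)
    intro y hy
    apply hzw
    refine ⟨by simpa using hc, by simpa using hst hy⟩
  have a1 := intervalIntegral.integral_add_adjacent_intervals
    (ii z.re left_mem_uIcc _ _ s1) (ii z.re left_mem_uIcc _ _ s2)
  have a2 := intervalIntegral.integral_add_adjacent_intervals
    (ii w.re right_mem_uIcc _ _ s1) (ii w.re right_mem_uIcc _ _ s2)
  rw [← a1, ← a2]
  simp only [smul_eq_mul] at *
  linear_combination e1 + e2

lemma kq_analyticAt_conj {f : ℂ → ℂ} {x : ℂ} (hf : AnalyticAt ℂ f x) :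
    AnalyticAt ℂ (fun w => starRingEnd ℂ (f (starRingEnd ℂ w))) (starRingEnd ℂ x) := by
  rw [Complex.analyticAt_iff_eventually_differentiableAt] at hf ⊢
  have hc : Tendsto (starRingEnd ℂ) (𝓝 (starRingEnd ℂ x)) (𝓝 x) := by
    have := Complex.continuous_conj.tendsto (starRingEnd ℂ x)
    simpa using this
  filter_upwards [hc.eventually hf] with w hw
  have := hw.conj_conj
  simpa [Function.comp_def] using this

lemma kq_meromorphicAt_conj {f : ℂ → ℂ} {x : ℂ} (hf : MeromorphicAt f x) :
    MeromorphicAt (fun w => starRingEnd ℂ (f (starRingEnd ℂ w))) (starRingEnd ℂ x) := by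
  obtain ⟨n, hn⟩ := hf
  refine ⟨n, ?_⟩
  have := kq_analyticAt_conj hn
  simpa using this

lemma kq_interval_exists (m : ℕ) (z : Fin m → ℝ) (hz : StrictMono z) (x : ℝ)
    (hx : ∀ k, x ≠ z k) : ∃ k, x ∈ intervalOf m z k := by
  classical
  have hex : ∃ k : ℕ, ∀ j : Fin m, k ≤ (j : ℕ) → x < z j :=
    ⟨m, fun j hj => absurd j.2 (by omega)⟩
  have hle : Nat.find hex ≤ m := Nat.find_min' hex (fun j hj => absurd j.2 (by omega))
  refine ⟨⟨Nat.find hex, by omega⟩, ?_, Nat.find_spec hex⟩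
  intro j hj
  have := Nat.find_min hex hj
  push Not at this
  obtain ⟨j', h1, h2⟩ := this
  exact lt_of_le_of_ne ((hz.monotone h1).trans h2) (hx j).symm

lemma kq_interval_open (m : ℕ) (z : Fin m → ℝ) (k : Fin (m + 1)) :
    IsOpen (intervalOf m z k) := by
  unfold intervalOf
  rw [ofPred_and]
  refine IsOpen.inter ?_ ?_
  · simp only [ofPred_forall]
    exact isOpen_iInter_of_finite fun j => isOpen_iInter_of_finite fun _ => isOpen_lt (by fun_prop) (by fun_prop)
  · simp only [ofPred_forall]
    exact isOpen_iInter_of_finite fun j => isOpen_iInter_of_finite fun _ => isOpen_lt (by fun_prop) (by fun_prop)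

lemma kq_interval_ne (m : ℕ) (z : Fin m → ℝ) (k : Fin (m + 1)) (x : ℝ)
    (hx : x ∈ intervalOf m z k) : ∀ j, x ≠ z j := by
  intro j
  rcases lt_or_ge (j : ℕ) (k : ℕ) with h | h
  · exact (hx.1 j h).ne'
  · exact (hx.2 j h).ne

lemma kq_upper_open : IsOpen {w : ℂ | 0 < w.im} := isOpen_lt continuous_const Complex.continuous_im

lemma kq_closure (x : ℂ) (hx : 0 ≤ x.im) : x ∈ closure {w : ℂ | 0 < w.im} := by
  have : closure {w : ℂ | 0 < w.im} = {w : ℂ | 0 ≤ w.im} := Complex.closure_setOfPred_lt_im 0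
  rw [this]; exact hx

/-- a value bound near `w` passes to the normal form, which is then analytic at `w`. -/
lemma kq_nf_bound (Q : ℂ → ℂ) (U : Set ℂ) (hQ : MeromorphicOn Q U) (w : ℂ) (hw : w ∈ U)
    (c : ℂ) (δ : ℝ) (hb : ∀ᶠ y in 𝓝[≠] w, Q y ∈ Metric.closedBall c δ) :
    AnalyticAt ℂ (toMeromorphicNFOn Q U) w ∧ toMeromorphicNFOn Q U w ∈ Metric.closedBall c δ := by
  have heq := hQ.toMeromorphicNFOn_eq_self_on_nhdsNE hw
  have hord : 0 ≤ meromorphicOrderAt Q w := by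
    by_contra hneg
    have ht := tendsto_cobounded_of_meromorphicOrderAt_neg (not_le.1 hneg)
    have h1 := ht.eventually (Bornology.isBounded_def.1 (Metric.isBounded_closedBall (x := c) (r := δ)))
    obtain ⟨y, hy1, hy2⟩ := (hb.and h1).exists
    exact hy2 hy1
  have han : AnalyticAt ℂ (toMeromorphicNFOn Q U) w := by
    rw [← (meromorphicNFOn_toMeromorphicNFOn Q U hw).meromorphicOrderAt_nonneg_iff_analyticAt,
      meromorphicOrderAt_toMeromorphicNFOn hQ hw]
    exact hord
  refine ⟨han, ?_⟩
  refine Metric.isClosed_closedBall.mem_of_tendsto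
    (han.continuousAt.continuousWithinAt (s := {w}ᶜ)) ?_
  filter_upwards [heq, hb] with y h1 h2
  rw [h1]; exact h2

lemma kq_nf_tendsto (Q : ℂ → ℂ) (U : Set ℂ) (hU : IsOpen U) (hQ : MeromorphicOn Q U) (x c : ℂ)
    (h : Tendsto Q (𝓝[U] x) (𝓝 c)) :
    Tendsto (toMeromorphicNFOn Q U) (𝓝[U] x) (𝓝 c) ∧
      ∀ᶠ w in 𝓝[U] x, AnalyticAt ℂ (toMeromorphicNFOn Q U) w := by
  have key : ∀ δ > 0, ∀ᶠ w in 𝓝[U] x, AnalyticAt ℂ (toMeromorphicNFOn Q U) w ∧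
      toMeromorphicNFOn Q U w ∈ Metric.closedBall c δ := by
    intro δ hδ
    have h1 : ∀ᶠ w in 𝓝[U] x, Q w ∈ Metric.closedBall c δ :=
      h.eventually (Metric.closedBall_mem_nhds c hδ)
    rw [← eventually_eventually_nhdsWithin] at h1
    filter_upwards [h1, self_mem_nhdsWithin] with w h2 hw
    rw [hU.nhdsWithin_eq hw] at h2
    exact kq_nf_bound Q U hQ w hw c δ (h2.filter_mono nhdsWithin_le_nhds)
  refine ⟨?_, (key 1 one_pos).mono fun _ h => h.1⟩
  rw [Metric.nhds_basis_closedBall.tendsto_right_iff]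
  exact fun δ hδ => (key δ hδ).mono fun _ h => h.2

/-- Schwarz reflection on a disc centred on the real line. -/
lemma kq_schwarz (f : ℂ → ℂ) (x₀ ε : ℝ) (r : ℝ → ℝ)
    (han : ∀ w ∈ Metric.ball (x₀ : ℂ) ε, 0 < w.im → AnalyticAt ℂ f w ∧ f w ≠ 0)
    (hr : ∀ x : ℝ, (x : ℂ) ∈ Metric.ball (x₀ : ℂ) ε →
      0 < r x ∧ Tendsto f (𝓝[{w : ℂ | 0 < w.im}] (x : ℂ)) (𝓝 (r x : ℂ))) :
    ∃ F : ℂ → ℂ, DifferentiableOn ℂ F (Metric.ball (x₀ : ℂ) ε) ∧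
      (∀ w ∈ Metric.ball (x₀ : ℂ) ε, F w ≠ 0) ∧
      (∀ w ∈ Metric.ball (x₀ : ℂ) ε, 0 < w.im → F w = f w) ∧
      (∀ w ∈ Metric.ball (x₀ : ℂ) ε, F (starRingEnd ℂ w) = starRingEnd ℂ (F w)) := by
  set U : Set ℂ := {w : ℂ | 0 < w.im} with hUdef
  set B := Metric.ball (x₀ : ℂ) ε with hB
  have hUo : IsOpen U := kq_upper_open
  have hBconj : ∀ w ∈ B, starRingEnd ℂ w ∈ B := by
    intro w hw
    rw [hB, Metric.mem_ball, dist_eq_norm] at hw ⊢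
    rwa [← Complex.norm_conj, map_sub, Complex.conj_conj, Complex.conj_ofReal]
  set g := extendFrom U f with hg
  have hgU : ∀ w ∈ B, 0 < w.im → g w = f w := by
    intro w hw hi
    exact extendFrom_eq (kq_closure w hi.le)
      ((han w hw hi).1.continuousAt.continuousWithinAt)
  have hgR : ∀ x : ℝ, (x : ℂ) ∈ B → g x = r x := by
    intro x hx
    exact extendFrom_eq (kq_closure x (by simp)) (hr x hx).2
  have hreal : ∀ w : ℂ, w.im = 0 → w = (w.re : ℂ) := by
    intro w hw
    apply Complex.ext <;> simp [hw]
  have hgc : ContinuousOn g (B ∩ {w : ℂ | 0 ≤ w.im}) := by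
    refine continuousOn_extendFrom (fun w hw => kq_closure w hw.2) ?_
    rintro w ⟨hw, hi⟩
    rcases (show 0 ≤ w.im from hi).eq_or_lt with h | h
    · have e := hreal w h.symm
      rw [e] at hw ⊢
      exact ⟨_, (hr _ hw).2⟩
    · exact ⟨_, ((han w hw h).1.continuousAt.continuousWithinAt)⟩
  have hgconj : ∀ w ∈ B, w.im = 0 → starRingEnd ℂ (g (starRingEnd ℂ w)) = g w := by
    intro w hw h
    have e := hreal w h
    rw [e] at hw ⊢
    rw [Complex.conj_ofReal, hgR _ hw, Complex.conj_ofReal]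
  classical
  let F : ℂ → ℂ := fun w => if 0 ≤ w.im then g w else starRingEnd ℂ (g (starRingEnd ℂ w))
  have hF1 : ∀ w, 0 ≤ w.im → F w = g w := fun w h => if_pos h
  have hF2 : ∀ w ∈ B, w.im ≤ 0 → F w = starRingEnd ℂ (g (starRingEnd ℂ w)) := by
    intro w hw h
    rcases h.eq_or_lt with h | h
    · rw [hF1 w h.ge, hgconj w hw h]
    · exact if_neg (not_le.2 h)
  have hFc : ContinuousOn F B := by
    have c1 : ContinuousOn F (B ∩ {w : ℂ | 0 ≤ w.im}) := hgc.congr fun w hw => hF1 w hw.2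
    have c2 : ContinuousOn F (B ∩ {w : ℂ | w.im ≤ 0}) := by
      have : ContinuousOn (fun w => starRingEnd ℂ (g (starRingEnd ℂ w))) (B ∩ {w : ℂ | w.im ≤ 0}) := by
        apply Complex.continuous_conj.comp_continuousOn
        apply hgc.comp Complex.continuous_conj.continuousOn
        rintro w ⟨hw, hi⟩
        exact ⟨hBconj w hw, by simpa using hi⟩
      exact this.congr fun w hw => hF2 w hw.1 hw.2
    intro w hw
    have hwithin : ContinuousWithinAt F (B ∩ {w : ℂ | 0 ≤ w.im} ∪ B ∩ {w : ℂ | w.im ≤ 0}) w := by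
      refine ContinuousWithinAt.union ?_ ?_
      · by_cases h : 0 ≤ w.im
        · exact c1 w ⟨hw, h⟩
        · refine continuousWithinAt_of_notMem_closure fun hc => h ?_
          exact closure_minimal (s := B ∩ {w : ℂ | 0 ≤ w.im}) (t := {w : ℂ | 0 ≤ w.im})
            inter_subset_right (isClosed_le continuous_const Complex.continuous_im) hc
      · by_cases h : w.im ≤ 0
        · exact c2 w ⟨hw, h⟩
        · refine continuousWithinAt_of_notMem_closure fun hc => h ?_
          exact closure_minimal (s := B ∩ {w : ℂ | w.im ≤ 0}) (t := {w : ℂ | w.im ≤ 0})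
            inter_subset_right (isClosed_le Complex.continuous_im continuous_const) hc
    refine hwithin.mono fun y hy => ?_
    rcases le_total 0 y.im with h | h
    · exact Or.inl ⟨hy, h⟩
    · exact Or.inr ⟨hy, h⟩
  have hBo : IsOpen B := Metric.isOpen_ball
  have hFU : ∀ w ∈ B, 0 < w.im → F w = f w := fun w hw h => by rw [hF1 w h.le, hgU w hw h]
  have hFL : ∀ w ∈ B, w.im < 0 → F w = starRingEnd ℂ (f (starRingEnd ℂ w)) := fun w hw h => by
    rw [hF2 w hw h.le, hgU _ (hBconj w hw) (by simpa using h)]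
  refine ⟨F, ?_, ?_, hFU, ?_⟩
  · refine kq_line_removable B F hBo hFc ?_
    rintro w ⟨hw, hi⟩
    apply DifferentiableAt.differentiableWithinAt
    rcases lt_or_gt_of_ne (show w.im ≠ 0 from hi) with h | h
    · have ha := kq_analyticAt_conj (han _ (hBconj w hw) (by simpa using h)).1
      rw [Complex.conj_conj] at ha
      refine ha.differentiableAt.congr_of_eventuallyEq ?_
      filter_upwards [hBo.mem_nhds hw,
        (isOpen_lt Complex.continuous_im continuous_const).mem_nhds h] with y h1 h2
      exact hFL y h1 h2
    · refine (han w hw h).1.differentiableAt.congr_of_eventuallyEq ?_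
      filter_upwards [hBo.mem_nhds hw, hUo.mem_nhds h] with y h1 h2
      exact hFU y h1 h2
  · intro w hw
    rcases lt_trichotomy w.im 0 with h | h | h
    · rw [hFL w hw h]
      simpa using (han _ (hBconj w hw) (by simpa using h)).2
    · rw [hF1 w h.ge]
      have e := hreal w h
      rw [e] at hw ⊢
      rw [hgR _ hw]
      exact_mod_cast (hr _ hw).1.ne'
    · rw [hFU w hw h]; exact (han w hw h).2
  · intro w hw
    rcases le_total w.im 0 with h | h
    · rw [hF2 w hw h, hF1 _ (by simpa using h), Complex.conj_conj]
    · rw [hF1 w h, hF2 _ (hBconj w hw) (by simpa using h), Complex.conj_conj]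

lemma kq_logDeriv_conj {F : ℂ → ℂ} {w : ℂ}
    (h : ∀ᶠ y in 𝓝 w, F (starRingEnd ℂ y) = starRingEnd ℂ (F y)) :
    logDeriv F w = starRingEnd ℂ (logDeriv F (starRingEnd ℂ w)) := by
  have e : F =ᶠ[𝓝 w] (starRingEnd ℂ) ∘ F ∘ (starRingEnd ℂ) := by
    filter_upwards [h] with y hy
    simp [hy]
  have h1 : deriv F w = starRingEnd ℂ (deriv F (starRingEnd ℂ w)) := by
    rw [e.deriv_eq, deriv_conj_conj]
    rfl
  have h2 : F w = starRingEnd ℂ (F (starRingEnd ℂ w)) := by simpa using e.eq_of_nhds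
  rw [logDeriv_apply, logDeriv_apply, map_div₀, ← h1, ← h2]

lemma kq_main (m : ℕ) (z : Fin m → ℝ) (hz : StrictMono z)
    (Q : ℂ → ℂ) (hQ : MeromorphicOn Q {w : ℂ | 0 < w.im})
    (Qb : ℝ → ℂ)
    (hext : ∀ x : ℝ, (∀ k, x ≠ z k) →
      Filter.Tendsto Q (nhdsWithin (x : ℂ) {w : ℂ | 0 < w.im}) (nhds (Qb x)))
    (hnv : ∀ x : ℝ, (∀ k, x ≠ z k) → Qb x ≠ 0)
    (θ : Fin (m + 1) → ℝ)
    (htraj : ∀ k : Fin (m + 1), ∀ x ∈ intervalOf m z k,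
      ∃ r : ℝ, 0 < r ∧ Complex.exp (-(2 * θ k) * Complex.I) * Qb x = r) :
    ∃ Ψ : ℂ → ℂ,
      MeromorphicOn Ψ {w : ℂ | ∀ k, w ≠ (z k : ℂ)} ∧
      (∀ w : ℂ, 0 < w.im → AnalyticAt ℂ Q w → Q w ≠ 0 →
        Ψ w = deriv Q w / Q w) ∧
      (∀ w : ℂ, w.im ≠ 0 → Ψ ((starRingEnd ℂ) w) = (starRingEnd ℂ) (Ψ w)) := by
  classical
  set U : Set ℂ := {w : ℂ | 0 < w.im} with hUdef
  have hUo : IsOpen U := kq_upper_open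
  have hLo : IsOpen {w : ℂ | w.im < 0} := isOpen_lt Complex.continuous_im continuous_const
  set N := toMeromorphicNFOn Q U with hN
  let Ψ : ℂ → ℂ := fun w => if 0 < w.im then logDeriv N w else
    if w.im < 0 then starRingEnd ℂ (logDeriv N (starRingEnd ℂ w)) else extendFrom U (logDeriv N) w
  have hU : ∀ w, 0 < w.im → Ψ w = logDeriv N w := fun w h => if_pos h
  have hL : ∀ w, w.im < 0 → Ψ w = starRingEnd ℂ (logDeriv N (starRingEnd ℂ w)) := fun w h => by
    simp only [Ψ, if_neg h.le.not_gt, if_pos h]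
  have hR : ∀ w, w.im = 0 → Ψ w = extendFrom U (logDeriv N) w := fun w h => by
    simp [Ψ, h]
  have hmer : ∀ w ∈ U, MeromorphicAt (logDeriv N) w := by
    intro w hw
    have hm : MeromorphicAt N w := (meromorphicNFOn_toMeromorphicNFOn Q U hw).meromorphicAt
    exact hm.deriv.div hm
  refine ⟨Ψ, ?_, ?_, ?_⟩
  · intro w hw
    rcases lt_trichotomy w.im 0 with h | h | h
    · have h1 := kq_meromorphicAt_conj (hmer (starRingEnd ℂ w) (by simpa [U] using h))
      rw [Complex.conj_conj] at h1
      refine h1.congr (EventuallyEq.filter_mono ?_ nhdsWithin_le_nhds)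
      filter_upwards [hLo.mem_nhds h] with y hy
      exact (hL y hy).symm
    swap
    · refine (hmer w h).congr (EventuallyEq.filter_mono ?_ nhdsWithin_le_nhds)
      filter_upwards [hUo.mem_nhds h] with y hy
      exact (hU y hy).symm
    -- boundary point
    obtain ⟨x₀, rfl⟩ : ∃ x : ℝ, w = (x : ℂ) := ⟨w.re, by apply Complex.ext <;> simp [h]⟩
    have hx₀ : ∀ k, x₀ ≠ z k := fun k hk => hw k (by rw [hk])
    obtain ⟨k, hk⟩ := kq_interval_exists m z hz x₀ hx₀
    have hNt : ∀ x : ℝ, (∀ j, x ≠ z j) → Tendsto N (𝓝[U] (x : ℂ)) (𝓝 (Qb x)) ∧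
        ∀ᶠ w in 𝓝[U] (x : ℂ), AnalyticAt ℂ N w := fun x hx =>
      kq_nf_tendsto Q U hUo hQ x (Qb x) (hext x hx)
    obtain ⟨ε, hε, hball⟩ : ∃ ε > 0, ∀ w ∈ Metric.ball (x₀ : ℂ) ε,
        (w ∈ U → AnalyticAt ℂ N w ∧ N w ≠ 0) ∧ w.re ∈ intervalOf m z k := by
      rw [← Metric.eventually_nhds_iff_ball]
      refine Eventually.and ?_ ?_
      · have h1 := (hNt x₀ hx₀).2.and ((hNt x₀ hx₀).1.eventually_ne (hnv x₀ hx₀))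
        exact eventually_nhdsWithin_iff.1 h1
      · refine Complex.continuous_re.continuousAt.eventually_mem ?_
        exact (kq_interval_open m z k).mem_nhds (by simpa using hk)
    set c := Complex.exp (-(2 * θ k) * Complex.I) with hc
    have hc0 : c ≠ 0 := Complex.exp_ne_zero _
    have htr : ∀ x : ℝ, ∃ r : ℝ, x ∈ intervalOf m z k → 0 < r ∧ c * Qb x = r := by
      intro x
      by_cases hx : x ∈ intervalOf m z k
      · obtain ⟨r, hr⟩ := htraj k x hx
        exact ⟨r, fun _ => hr⟩
      · exact ⟨0, fun h => absurd h hx⟩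
    choose r hr using htr
    obtain ⟨F, hFd, hF0, hFU, hFc⟩ := kq_schwarz (fun w => c * N w) x₀ ε r
      (fun w hw hi => ⟨analyticAt_const.mul ((hball w hw).1 hi).1,
        mul_ne_zero hc0 ((hball w hw).1 hi).2⟩)
      (fun x hx => by
        have hxi : x ∈ intervalOf m z k := by simpa using (hball x hx).2
        refine ⟨(hr x hxi).1, ?_⟩
        rw [← (hr x hxi).2]
        exact ((hNt x (kq_interval_ne m z k x hxi)).1).const_mul c)
    set B := Metric.ball (x₀ : ℂ) ε with hB
    have hBo : IsOpen B := Metric.isOpen_ball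
    have hBconj : ∀ w ∈ B, starRingEnd ℂ w ∈ B := by
      intro w hw
      rw [hB, Metric.mem_ball, dist_eq_norm] at hw ⊢
      rwa [← Complex.norm_conj, map_sub, Complex.conj_conj, Complex.conj_ofReal]
    have hFan : ∀ w ∈ B, AnalyticAt ℂ F w := fun w hw => hFd.analyticAt (hBo.mem_nhds hw)
    have hLan : ∀ w ∈ B, AnalyticAt ℂ (logDeriv F) w := fun w hw =>
      (hFan w hw).deriv.div (hFan w hw) (hF0 w hw)
    have eU : ∀ w ∈ B, 0 < w.im → logDeriv N w = logDeriv F w := by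
      intro w hw hi
      have e : F =ᶠ[𝓝 w] fun y => c * N y := by
        filter_upwards [hBo.mem_nhds hw, hUo.mem_nhds hi] with y h1 h2
        exact hFU y h1 h2
      rw [logDeriv_apply, logDeriv_apply, e.deriv_eq, e.eq_of_nhds,
        deriv_const_mul_field, mul_div_mul_left _ _ hc0]
    refine (hLan x₀ (Metric.mem_ball_self hε)).meromorphicAt.congr
      (EventuallyEq.filter_mono ?_ nhdsWithin_le_nhds)
    filter_upwards [hBo.mem_nhds (Metric.mem_ball_self hε)] with y hy
    rcases lt_trichotomy y.im 0 with hi | hi | hi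
    · rw [hL y hi, eU _ (hBconj y hy) (by simpa using hi)]
      refine kq_logDeriv_conj ?_
      filter_upwards [hBo.mem_nhds hy] with u hu
      exact hFc u hu
    · rw [hR y hi]
      refine (extendFrom_eq (kq_closure y hi.ge) ?_).symm
      refine ((hLan y hy).continuousAt.continuousWithinAt (s := U)).tendsto.congr' ?_
      filter_upwards [self_mem_nhdsWithin, mem_nhdsWithin_of_mem_nhds (hBo.mem_nhds hy)] with u h1 h2
      exact (eU u h2 h1).symm
    · rw [hU y hi, eU y hy hi]
  · intro w hw ha _
    have e : N =ᶠ[𝓝 w] Q :=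
      ((meromorphicNFOn_toMeromorphicNFOn Q U hw).eventuallyEq_nhdsNE_iff_eventuallyEq_nhds
        ha.meromorphicNFAt).1 (hQ.toMeromorphicNFOn_eq_self_on_nhdsNE hw)
    rw [hU w hw, logDeriv_apply, e.deriv_eq, e.eq_of_nhds]
  · intro w hw
    rcases lt_or_gt_of_ne hw with h | h
    · rw [hL w h, hU _ (by simpa using h), Complex.conj_conj]
    · rw [hU w h, hL _ (by simpa using h), Complex.conj_conj]

end KQ

/-- reflection step: the logarithmic derivative of a Kühnau quadratic
differential on `ℍ` extends meromorphically to `ℂ ∖ {z₁,…,z_m}`, symmetrically under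
conjugation.  Here `Q` is meromorphic on `ℍ`, extends continuously to each boundary
interval with nonvanishing limit `Qb`, and on each complementary interval there is
`θ_k ∈ [0,π)` with `e^{-2iθ_k}·Qb > 0` (each boundary interval is a θ_k-trajectory
arc).  Then there is `Ψ` meromorphic on `ℂ ∖ {z₁,…,z_m}` agreeing with `Q'/Q` on `ℍ`
(wherever `Q` is holomorphic and nonzero) and satisfying `Ψ(conj z) = conj (Ψ z)`. -/
theorem stmt_2 (m : ℕ) (z : Fin m → ℝ) (hz : StrictMono z)
    (Q : ℂ → ℂ) (hQ : MeromorphicOn Q {w : ℂ | 0 < w.im})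
    (Qb : ℝ → ℂ)
    (hext : ∀ x : ℝ, (∀ k, x ≠ z k) →
      Filter.Tendsto Q (nhdsWithin (x : ℂ) {w : ℂ | 0 < w.im}) (nhds (Qb x)))
    (hnv : ∀ x : ℝ, (∀ k, x ≠ z k) → Qb x ≠ 0)
    (θ : Fin (m + 1) → ℝ) (hθ : ∀ k, θ k ∈ Set.Ico (0 : ℝ) Real.pi)
    (htraj : ∀ k : Fin (m + 1), ∀ x ∈ intervalOf m z k,
      ∃ r : ℝ, 0 < r ∧ Complex.exp (-(2 * θ k) * Complex.I) * Qb x = r) :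
    ∃ Ψ : ℂ → ℂ,
      MeromorphicOn Ψ {w : ℂ | ∀ k, w ≠ (z k : ℂ)} ∧
      (∀ w : ℂ, 0 < w.im → AnalyticAt ℂ Q w → Q w ≠ 0 →
        Ψ w = deriv Q w / Q w) ∧
      (∀ w : ℂ, w.im ≠ 0 → Ψ ((starRingEnd ℂ) w) = (starRingEnd ℂ) (Ψ w)) := by
  exact kq_main m z hz Q hQ Qb hext hnv θ htraj
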